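/- Let k ≥ 3, 1 ≤ a ≤ k−1, m ≥ 1, and let V^λ be an irreducible highest weight U_q(sl_k)-module with highest weight λ = mω_a and highest weight vector v_λ. For 0 ≤ j ≤ m, set v_j := f_{k−1}^{(j)} ⋯ f_a^{(j)} v_λ. Then V^λ decomposes as the internal direct sum of U_q(sl_{k−1})-submodules: V^λ = ⊕_{j=0}^m U_q(sl_{k−1}) v_j. -/

import Mathlib

/-!
Common setup: the quantum group `U_q(sl_k)` (presented by generators
`e_i, f_i, K_i = q^{h_i}, K_i⁻¹` for `1 ≤ i ≤ k-1` and the standard relations)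
over the field `KK = ℚ(q)`, and the notion of an irreducible highest weight
module.  Weights are recorded as functions `μ : ℕ → ℤ`, `μ i` being the value
`μ(h_i)` on the `i`-th simple coroot.
-/

noncomputable section
namespace QSL

abbrev KK : Type := RatFunc ℚ

/-- the variable `q`. -/
def qv : KK := RatFunc.X

/-- the quantum integer `[n]_q = (qⁿ - q⁻ⁿ)/(q - q⁻¹)`. -/
def qInt (n : ℕ) : KK := (qv ^ n - qv⁻¹ ^ n) / (qv - qv⁻¹)

/-- the quantum factorial `[n]_q!`. -/
def qFact : ℕ → KK
  | 0 => 1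
  | n + 1 => qFact n * qInt (n + 1)

/-- the Gaussian binomial coefficient `[m choose j]_q`. -/
def qBinom (m j : ℕ) : KK :=
  (∏ t ∈ Finset.range j, qInt (m - t)) / (∏ t ∈ Finset.range j, qInt (j - t))

/-- the Cartan matrix of `sl`:  `cartan i j = αⱼ(h_i)`. -/
def cartan (i j : ℕ) : ℤ := if i = j then 2 else if i + 1 = j ∨ j + 1 = i then -1 else 0

/-- The quantum group with `d` nodes (`d = k - 1` for `U_q(sl_k)`): a unital
associative `ℚ(q)`-algebra generated by elements `e i, f i, K i, Kinv i`
(`1 ≤ i ≤ d`, where `K i = q^{h_i}`) subject to the standard relations. -/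
structure QGroup (d : ℕ) where
  U : Type
  [ring : Ring U]
  [alg : Algebra KK U]
  e : ℕ → U
  f : ℕ → U
  K : ℕ → U
  Kinv : ℕ → U
  K_mul_Kinv : ∀ i, 1 ≤ i → i ≤ d → K i * Kinv i = 1
  Kinv_mul_K : ∀ i, 1 ≤ i → i ≤ d → Kinv i * K i = 1
  K_comm : ∀ i j, 1 ≤ i → i ≤ d → 1 ≤ j → j ≤ d → K i * K j = K j * K i
  K_e_Kinv : ∀ i j, 1 ≤ i → i ≤ d → 1 ≤ j → j ≤ d →
      K i * e j * Kinv i = (qv ^ cartan i j) • e j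
  K_f_Kinv : ∀ i j, 1 ≤ i → i ≤ d → 1 ≤ j → j ≤ d →
      K i * f j * Kinv i = (qv ^ (-cartan i j)) • f j
  e_f_comm : ∀ i j, 1 ≤ i → i ≤ d → 1 ≤ j → j ≤ d →
      e i * f j - f j * e i = if i = j then (qv - qv⁻¹)⁻¹ • (K i - Kinv i) else 0
  serre_e : ∀ i j, 1 ≤ i → i ≤ d → 1 ≤ j → j ≤ d → (i + 1 = j ∨ j + 1 = i) →
      e i * e i * e j - (qv + qv⁻¹) • (e i * e j * e i) + e j * e i * e i = 0
  serre_f : ∀ i j, 1 ≤ i → i ≤ d → 1 ≤ j → j ≤ d → (i + 1 = j ∨ j + 1 = i) →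
      f i * f i * f j - (qv + qv⁻¹) • (f i * f j * f i) + f j * f i * f i = 0
  comm_e : ∀ i j, 1 ≤ i → i ≤ d → 1 ≤ j → j ≤ d → (i + 1 < j ∨ j + 1 < i) →
      e i * e j = e j * e i
  comm_f : ∀ i j, 1 ≤ i → i ≤ d → 1 ≤ j → j ≤ d → (i + 1 < j ∨ j + 1 < i) →
      f i * f j = f j * f i
  gen : ∀ x : U, x ∈ Algebra.adjoin KK
      {y : U | ∃ i, 1 ≤ i ∧ i ≤ d ∧ (y = e i ∨ y = f i ∨ y = K i ∨ y = Kinv i)}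

attribute [instance] QGroup.ring QGroup.alg

variable {d : ℕ} (G : QGroup d)

/-- the divided power `f_i^{(n)} = f_iⁿ/[n]_q!`. -/
def fDiv (i n : ℕ) : G.U := (qFact n)⁻¹ • (G.f i) ^ n

/-- the divided power `e_i^{(n)} = e_iⁿ/[n]_q!`. -/
def eDiv (i n : ℕ) : G.U := (qFact n)⁻¹ • (G.e i) ^ n

variable {V : Type} [AddCommGroup V] [Module KK V] [Module G.U V] [IsScalarTower KK G.U V]

/-- `u` is a weight vector of weight `μ` (recorded via `μ i = μ(h_i)`). -/
def IsWtVec (u : V) (μ : ℕ → ℤ) : Prop :=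
  ∀ i, 1 ≤ i → i ≤ d → G.K i • u = (qv ^ μ i) • u

/-- `V` is an irreducible highest weight module over `G` with highest weight
`lam` and highest weight vector `v`: it is finite dimensional over `ℚ(q)`,
has a weight space decomposition, `v` is a nonzero weight vector of weight
`lam` annihilated by the `e_i`, `V` is generated by `v`, and `V` is
irreducible. -/
structure IsHWModule (lam : ℕ → ℤ) (v : V) : Prop where
  findim : FiniteDimensional KK V
  ne_zero : v ≠ 0
  wt : IsWtVec G v lam
  hw : ∀ i, 1 ≤ i → i ≤ d → G.e i • v = 0
  gen : ∀ w : V, ∃ p : G.U, p • v = w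
  irred : ∀ W : Submodule G.U V, W = ⊥ ∨ W = ⊤
  decomp : Submodule.span KK {u : V | ∃ μ : ℕ → ℤ, IsWtVec G u μ} = ⊤

/-- the weight `m ω_a`. -/
def omWt (a m : ℕ) : ℕ → ℤ := fun i => if i = a then (m : ℤ) else 0

/-- the weight `j ω_{a-1} + (m - j) ω_a`. -/
def hookWt (a m j : ℕ) : ℕ → ℤ := fun i =>
  (if i = a - 1 then (j : ℤ) else 0) + (if i = a then (m : ℤ) - (j : ℤ) else 0)

/-- `f_{a'}^{(c_{a'})} ⋯ f_{a+1}^{(c_{a+1})} f_a^{(c_a)} • v`. -/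
def fDivChain (c : ℕ → ℕ) (a a' : ℕ) (v : V) : V :=
  (List.range (a' + 1 - a)).foldl (fun u r => fDiv G (a + r) (c (a + r)) • u) v

/-- the generators `e_i, f_i, K_i, K_i⁻¹` with `1 ≤ i ≤ b`. -/
def subGens (b : ℕ) : Set G.U :=
  {y | ∃ i, 1 ≤ i ∧ i ≤ b ∧ (y = G.e i ∨ y = G.f i ∨ y = G.K i ∨ y = G.Kinv i)}

/-- the subalgebra `U_q(sl_{b+1}) ⊆ U_q(sl_{d+1})` generated by
`e_i, f_i, q^{±h_i}` for `1 ≤ i ≤ b`. -/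
def Usub (b : ℕ) : Subalgebra KK G.U := Algebra.adjoin KK (subGens G b)

/-- the subspace `U_q(sl_{b+1}) • x ⊆ V`. -/
def USpan (b : ℕ) (x : V) : Submodule KK V :=
  Submodule.span KK {w : V | ∃ p ∈ Usub G b, w = p • x}

/-! ### Powers of `q` -/

lemma qv_ne_zero : qv ≠ 0 := RatFunc.X_ne_zero

lemma qv_pow_ne_one {n : ℕ} (hn : n ≠ 0) : qv ^ n ≠ 1 := by
  intro h
  have h' : algebraMap (Polynomial ℚ) KK (Polynomial.X ^ n) = algebraMap (Polynomial ℚ) KK 1 := by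
    simpa [qv, RatFunc.algebraMap_X] using h
  have h2 := congrArg Polynomial.natDegree (RatFunc.algebraMap_injective ℚ h')
  simp at h2
  exact hn h2

lemma qv_zpow_injective : Function.Injective (fun n : ℤ => qv ^ n) := by
  have key : ∀ n : ℤ, qv ^ n = 1 → n = 0 := by
    intro n h
    by_contra hn
    have hn' : n.natAbs ≠ 0 := by omega
    apply qv_pow_ne_one hn'
    rcases Int.natAbs_eq n with h1 | h1
    · rw [h1, zpow_natCast] at h
      exact h
    · rw [h1, zpow_neg, zpow_natCast] at h
      exact inv_eq_one.mp h
  intro a b h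
  have h1 : qv ^ (a - b) = 1 := by
    rw [zpow_sub₀ qv_ne_zero]
    exact (div_eq_one_iff_eq (zpow_ne_zero _ qv_ne_zero)).mpr h
  have := key _ h1
  omega

lemma qv_sub_inv_ne_zero : qv - qv⁻¹ ≠ 0 := by
  intro h
  have h1 : qv ^ (1 : ℤ) = qv ^ (-1 : ℤ) := by simpa using sub_eq_zero.mp h
  have := qv_zpow_injective h1
  omega

lemma qv_add_inv_ne_zero : qv + qv⁻¹ ≠ 0 := by
  intro h
  have h0 := qv_ne_zero
  apply qv_pow_ne_one (n := 4) (by norm_num)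
  field_simp at h
  linear_combination (qv ^ 2 - 1) * h

lemma qInt_ne_zero {n : ℕ} (hn : n ≠ 0) : qInt n ≠ 0 := by
  unfold qInt
  refine div_ne_zero (fun h => ?_) qv_sub_inv_ne_zero
  have h1 : qv ^ (n : ℤ) = qv ^ (-(n : ℤ)) := by simpa using sub_eq_zero.mp h
  have := qv_zpow_injective h1
  omega

lemma qFact_ne_zero : ∀ n, qFact n ≠ 0
  | 0 => one_ne_zero
  | n + 1 => mul_ne_zero (qFact_ne_zero n) (qInt_ne_zero n.succ_ne_zero)

/-! ### Identities for `q`-commutators -/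

section Bracket

variable {F A : Type*} [Field F] [Ring A] [Algebra F A] {q : F}

/-- The `q`-commutator `x y - q y x`. -/
def qBracket (q : F) (x y : A) : A := x * y - q • (y * x)

/-- The quantum Serre relation for an ordered pair. -/
def SerreRel (q : F) (x y : A) : Prop :=
  x * x * y - (q + q⁻¹) • (x * y * x) + y * x * x = 0

lemma mul_qBracket_of_serreRel (hq : q ≠ 0) {x y : A} (h : SerreRel q x y) :
    x * qBracket q x y = q⁻¹ • (qBracket q x y * x) := by
  unfold SerreRel at h
  unfold qBracket
  simp only [mul_sub, sub_mul, mul_smul_comm, smul_mul_assoc, mul_assoc] at h ⊢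
  linear_combination (norm := skip) h
  match_scalars <;> field_simp <;> ring

lemma mul_qBracket_of_serreRel_swap (hq : q ≠ 0) {x y : A} (h : SerreRel q y x) :
    y * qBracket q x y = q • (qBracket q x y * y) := by
  unfold SerreRel at h
  unfold qBracket
  simp only [mul_sub, sub_mul, mul_smul_comm, smul_mul_assoc, mul_assoc] at h ⊢
  linear_combination (norm := skip) (-q) • h
  match_scalars <;> field_simp <;> ring

lemma mul_qBracket_of_comm {x y z : A} (hx : z * x = x * z) (hy : z * y = y * z) :
    z * qBracket q x y = qBracket q x y * z := by
  unfold qBracket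
  simp only [mul_sub, sub_mul, mul_smul_comm, smul_mul_assoc]
  rw [← mul_assoc, hx, mul_assoc, hy, ← mul_assoc z, hy, mul_assoc y, hx]
  simp only [mul_assoc]

lemma mul_qBracket_of_comm_left {x y z : A} {c : F} (hx : z * x = x * z)
    (hy : z * y = c • (y * z)) :
    z * qBracket q x y = c • (qBracket q x y * z) := by
  unfold qBracket
  simp only [mul_sub, sub_mul, mul_smul_comm, smul_mul_assoc]
  rw [← mul_assoc, hx, mul_assoc, hy, ← mul_assoc z, hy, smul_mul_assoc, mul_assoc y, hx]
  simp only [mul_assoc, mul_smul_comm, smul_sub]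
  module

lemma qBracket_mul_of_comm {x y z : A} {c : F} (hx : x * z = z * x)
    (hy : y * z = c • (z * y)) :
    qBracket q x y * z = c • (z * qBracket q x y) := by
  unfold qBracket
  simp only [mul_sub, sub_mul, mul_smul_comm, smul_mul_assoc]
  rw [mul_assoc, hy, mul_assoc y, hx, ← mul_assoc y, hy, mul_smul_comm, ← mul_assoc x, hx]
  simp only [mul_assoc, smul_mul_assoc, smul_sub]
  module

lemma SerreRel.qBracket_right {x y z : A} (h : SerreRel q x y) (hz : x * z = z * x) :
    SerreRel q x (qBracket q y z) := by
  unfold SerreRel at *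
  have e1 : x * (x * (y * z)) = (q + q⁻¹) • (x * (y * (z * x))) - y * (z * (x * x)) := by
    have := congrArg (· * z) h
    simp only [sub_mul, add_mul, smul_mul_assoc, mul_assoc, zero_mul] at this
    rw [hz] at this
    rw [← mul_assoc x z x, hz, mul_assoc z x x] at this
    linear_combination (norm := module) this
  have e2 : x * (x * (z * y)) = (q + q⁻¹) • (x * (z * (y * x))) - z * (y * (x * x)) := by
    have := congrArg (z * ·) h
    simp only [mul_sub, mul_add, mul_smul_comm, mul_assoc, mul_zero] at this
    rw [← mul_assoc z x, ← mul_assoc z x, ← hz] at this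
    simp only [mul_assoc] at this
    rw [← mul_assoc z x y, ← hz, mul_assoc x z y] at this
    linear_combination (norm := module) this
  unfold qBracket
  simp only [mul_sub, sub_mul, mul_smul_comm, smul_mul_assoc, mul_assoc]
  rw [e1, e2]
  module

lemma mul_qBracket_qBracket (hq : q ≠ 0) (hq2 : q + q⁻¹ ≠ 0) {x y z : A}
    (hxz : x * z = z * x) (hyx : SerreRel q y x) (hyz : SerreRel q y z) :
    y * qBracket q x (qBracket q y z) = qBracket q x (qBracket q y z) * y := by
  unfold SerreRel at hyx hyz
  have hl : ∀ w : A, x * (z * w) = z * (x * w) := fun w => by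
    rw [← mul_assoc, hxz, mul_assoc]
  have r1 := congrArg (· * z) hyx
  have r2 := congrArg (z * ·) hyx
  have r3 := congrArg (x * ·) hyz
  have r4 := congrArg (· * x) hyz
  unfold qBracket
  simp only [mul_sub, sub_mul, mul_add, add_mul, mul_smul_comm, smul_mul_assoc, mul_assoc,
    zero_mul, mul_zero, hl, hxz] at r1 r2 r3 r4 ⊢
  apply smul_right_injective A hq2
  beta_reduce
  linear_combination (norm := skip) (-1 : F) • r1 + (q ^ 2) • r2 + r3 - (q ^ 2) • r4
  match_scalars <;> field_simp <;> ring

end Bracket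

section BracketModule

variable {F A M : Type*} [Field F] [Ring A] [Algebra F A] [AddCommGroup M] [Module F M]
  [Module A M] [IsScalarTower F A M] {q : F}

lemma geom_sum_ne_zero_of_pow_ne_one {x : F} (n : ℕ) (hx : x ^ (n + 1) ≠ 1) :
    ∑ t ∈ Finset.range (n + 1), x ^ t ≠ 0 := by
  intro h
  have := geom_sum_mul x (n + 1)
  rw [h, zero_mul] at this
  exact hx (sub_eq_zero.mp this.symm)

/-- If `x` kills `w`, then `x` acts on `yⁿ⁺¹ w` through the bracket `[x, y]_q`. -/
lemma smul_pow_succ_smul_of_qBracket {x y : A} {w : M}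
    (hz : y * qBracket q x y = q • (qBracket q x y * y)) (hw : x • w = 0) (n : ℕ) :
    x • y ^ (n + 1) • w =
      (∑ t ∈ Finset.range (n + 1), (q ^ 2) ^ t) • qBracket q x y • y ^ n • w := by
  have hxy : x * y = q • (y * x) + qBracket q x y := by
    unfold qBracket
    module
  induction n with
  | zero => simp [qBracket, sub_smul, mul_smul, hw]
  | succ n ih =>
    have h1 : x • y ^ (n + 2) • w = q • y • x • y ^ (n + 1) • w
        + qBracket q x y • y ^ (n + 1) • w := by
      rw [pow_succ' y (n + 1), mul_smul, ← mul_smul, hxy, add_smul, smul_assoc, mul_smul]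
    have h2 : y • qBracket q x y • y ^ n • w = q • qBracket q x y • y ^ (n + 1) • w := by
      rw [← mul_smul, hz, smul_assoc, mul_smul, pow_succ', mul_smul]
    rw [h1, ih, smul_comm y, h2, geom_sum_succ (n := n + 1)]
    generalize qBracket q x y • y ^ (n + 1) • w = u
    module

lemma smul_pow_succ_smul_of_qBracket_swap (hq : q ≠ 0) {x y : A} {w : M}
    (hz : x * qBracket q x y = q⁻¹ • (qBracket q x y * x)) (hw : y • w = 0) (n : ℕ) :
    y • x ^ (n + 1) • w =
      (-q⁻¹ * ∑ t ∈ Finset.range (n + 1), (q⁻¹ ^ 2) ^ t) • qBracket q x y • x ^ n • w := by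
  have hxy : y * x = q⁻¹ • (x * y - qBracket q x y) := by
    unfold qBracket
    match_scalars <;> field_simp
    ring
  induction n with
  | zero =>
    rw [pow_one, ← mul_smul, hxy]
    simp [sub_smul, mul_smul, hw]
  | succ n ih =>
    have h1 : y • x ^ (n + 2) • w = q⁻¹ • (x • y • x ^ (n + 1) • w
        - qBracket q x y • x ^ (n + 1) • w) := by
      rw [pow_succ' x (n + 1), mul_smul, ← mul_smul, hxy, smul_assoc, sub_smul, mul_smul]
    have h2 : x • qBracket q x y • x ^ n • w = q⁻¹ • qBracket q x y • x ^ (n + 1) • w := by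
      rw [← mul_smul, hz, smul_assoc, mul_smul, pow_succ', mul_smul]
    rw [h1, ih, smul_comm x, h2, geom_sum_succ (n := n + 1)]
    generalize qBracket q x y • x ^ (n + 1) • w = u
    module

lemma pow_mul_of_qComm {x z : A} {c : F} (h : x * z = c • (z * x)) (n : ℕ) :
    x ^ n * z = c ^ n • (z * x ^ n) := by
  induction n with
  | zero => simp
  | succ n ih =>
    rw [pow_succ', mul_assoc, ih, mul_smul_comm, ← mul_assoc, h, smul_mul_assoc, smul_smul,
      mul_assoc, ← pow_succ]

lemma mul_pow_of_qComm {x z : A} {c : F} (h : z * x = c • (x * z)) (n : ℕ) :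
    z * x ^ n = c ^ n • (x ^ n * z) := by
  induction n with
  | zero => simp
  | succ n ih =>
    rw [pow_succ, ← mul_assoc, ih, smul_mul_assoc, mul_assoc, h, mul_smul_comm, smul_smul,
      mul_assoc, ← pow_succ]

/-- `yⁿ xⁿ w` is a nonzero multiple of `[x, y]_qⁿ w` when `y` kills `w`. -/
lemma exists_pow_smul_pow_smul_eq (hq : ∀ n : ℕ, n ≠ 0 → q ^ n ≠ 1) (hq0 : q ≠ 0) {x y : A} {w : M}
    (hx : x * qBracket q x y = q⁻¹ • (qBracket q x y * x))
    (hy : y * qBracket q x y = q • (qBracket q x y * y)) (hw : y • w = 0) (n : ℕ) :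
    ∃ c : F, c ≠ 0 ∧ y ^ n • x ^ n • w = c • qBracket q x y ^ n • w := by
  induction n with
  | zero => exact ⟨1, one_ne_zero, by simp⟩
  | succ n ih =>
    obtain ⟨c, hc, h⟩ := ih
    refine ⟨(-q⁻¹ * ∑ t ∈ Finset.range (n + 1), (q⁻¹ ^ 2) ^ t) * q ^ n * c, ?_, ?_⟩
    · have : ∑ t ∈ Finset.range (n + 1), (q⁻¹ ^ 2) ^ t ≠ 0 := by
        apply geom_sum_ne_zero_of_pow_ne_one
        rw [← pow_mul, inv_pow]
        exact fun h => hq _ (by omega) (inv_eq_one.mp h)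
      have h1 : -q⁻¹ ≠ 0 := neg_ne_zero.mpr (inv_ne_zero hq0)
      positivity
    · rw [pow_succ y, mul_smul, smul_pow_succ_smul_of_qBracket_swap hq0 hx hw, smul_comm (y ^ n),
        ← mul_smul (y ^ n), pow_mul_of_qComm hy, smul_assoc, mul_smul (qBracket q x y), h,
        smul_comm (qBracket q x y) c, ← mul_smul (qBracket q x y), ← pow_succ']
      generalize qBracket q x y ^ (n + 1) • w = u
      module

lemma smul_pow_succ_smul_of_sl2 (hq : q ≠ 0) (hq1 : q - q⁻¹ ≠ 0) {e f K K' : A} {w : M} {c : ℤ}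
    (hef : e * f - f * e = (q - q⁻¹)⁻¹ • (K - K'))
    (hK : ∀ n : ℕ, K • f ^ n • w = q ^ (c - 2 * n) • f ^ n • w)
    (hK' : ∀ n : ℕ, K' • f ^ n • w = q ^ (-(c - 2 * n)) • f ^ n • w) (he : e • w = 0) (n : ℕ) :
    e • f ^ (n + 1) • w = ((q ^ (n + 1 : ℤ) - q ^ (-(n + 1) : ℤ)) * (q ^ (c - n) - q ^ (n - c))
      / (q - q⁻¹) ^ 2) • f ^ n • w := by
  have hef' : ∀ u : M, e • f • u = f • e • u + (q - q⁻¹)⁻¹ • (K • u - K' • u) := fun u => by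
    rw [← mul_smul, sub_eq_iff_eq_add'.mp hef, add_smul, mul_smul, smul_assoc, sub_smul]
  have hstep : ∀ n : ℕ, e • f ^ (n + 1) • w = f • e • f ^ n • w
      + ((q - q⁻¹)⁻¹ * (q ^ (c - 2 * n) - q ^ (-(c - 2 * n)))) • f ^ n • w := fun n => by
    rw [pow_succ', mul_smul, hef', hK, hK']
    generalize f • e • f ^ n • w = u
    generalize f ^ n • w = u'
    module
  induction n with
  | zero =>
    rw [hstep]
    simp only [pow_zero, one_smul, he, smul_zero, zero_add]
    congr 1
    simp only [Nat.cast_zero, mul_zero, sub_zero, zero_sub, zpow_neg, zero_add, zpow_one]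
    field_simp
  | succ n ih =>
    rw [hstep, ih, smul_comm f, ← mul_smul f, ← pow_succ', ← add_smul]
    congr 1
    obtain ⟨x, hx⟩ : ∃ x, x = q ^ (n : ℤ) := ⟨_, rfl⟩
    obtain ⟨y, hy⟩ : ∃ y, y = q ^ c := ⟨_, rfl⟩
    have hx0 : x ≠ 0 := hx ▸ zpow_ne_zero _ hq
    have hy0 : y ≠ 0 := hy ▸ zpow_ne_zero _ hq
    have h2 : q ^ (2 * (n : ℤ)) = x ^ 2 := by rw [hx, mul_comm, zpow_mul]; norm_cast
    have h3 : q ^ (2 : ℤ) = q ^ 2 := by norm_cast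
    push_cast
    simp only [neg_sub, mul_add, mul_one, neg_add_rev, zpow_sub₀ hq, zpow_add₀ hq, zpow_neg,
      h2, ← hx, ← hy, zpow_one, h3]
    have hq2 : q ^ 2 - 1 ≠ 0 := by
      intro h
      apply hq1
      field_simp
      simpa using h
    field_simp
    ring

end BracketModule

/-! ### Root vectors -/

/-- The root vectors attached to the roots `α_{d-r} + ⋯ + α_d`. -/
def rootVecAux : ℕ → G.U
  | 0 => G.f d
  | r + 1 => qBracket qv (G.f (d - (r + 1))) (rootVecAux r)

/-- The root vector attached to the root `α_i + ⋯ + α_d`. -/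
def rootVec (i : ℕ) : G.U := rootVecAux G (d - i)

lemma rootVec_top : rootVec G d = G.f d := by simp [rootVec, rootVecAux]

lemma rootVec_of_lt {i : ℕ} (hi : i < d) :
    rootVec G i = qBracket qv (G.f i) (rootVec G (i + 1)) := by
  obtain ⟨r, hr⟩ : ∃ r, d - i = r + 1 := ⟨d - i - 1, by omega⟩
  have h1 : d - (i + 1) = r := by omega
  have h2 : d - (r + 1) = i := by omega
  simp only [rootVec, hr, h1, rootVecAux, h2]

lemma f_mul_rootVec_of_add_one_lt {i j : ℕ} (hj : 1 ≤ j) (hji : j + 1 < i) (hi : i ≤ d) :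
    G.f j * rootVec G i = rootVec G i * G.f j := by
  revert hji
  induction hi using Nat.decreasingInduction with
  | self =>
    intro hji
    rw [rootVec_top]
    exact G.comm_f j d hj (by omega) (by omega) le_rfl (Or.inl hji)
  | of_succ i hi ih =>
    intro hji
    rw [rootVec_of_lt G hi]
    exact mul_qBracket_of_comm (G.comm_f j i hj (by omega) (by omega) hi.le (Or.inl hji))
      (ih (by omega))

lemma serreRel_f_rootVec {i : ℕ} (hi : 1 ≤ i) (hid : i < d) :
    SerreRel qv (G.f i) (rootVec G (i + 1)) := by
  rcases (show i + 1 ≤ d from hid).eq_or_lt with h | h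
  · rw [h, rootVec_top]
    exact G.serre_f i d hi hid.le (by omega) le_rfl (Or.inl h)
  · rw [rootVec_of_lt G h]
    exact SerreRel.qBracket_right
      (G.serre_f i (i + 1) hi hid.le (by omega) hid (Or.inl rfl))
      (f_mul_rootVec_of_add_one_lt G hi (by omega) (by omega))

lemma f_mul_rootVec_self {i : ℕ} (hi : 1 ≤ i) (hid : i < d) :
    G.f i * rootVec G i = qv⁻¹ • (rootVec G i * G.f i) := by
  rw [rootVec_of_lt G hid]
  exact mul_qBracket_of_serreRel qv_ne_zero (serreRel_f_rootVec G hi hid)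

lemma f_mul_rootVec_of_lt {i j : ℕ} (hi : 1 ≤ i) (hij : i < j) (hj : j < d) :
    G.f j * rootVec G i = rootVec G i * G.f j := by
  have hij' : i ≤ j - 1 := by omega
  revert hi hij
  induction hij' using Nat.decreasingInduction with
  | self =>
    intro hi hij
    obtain ⟨i, rfl⟩ : ∃ i, j = i + 1 := ⟨j - 1, by omega⟩
    simp only [Nat.add_sub_cancel] at *
    rw [rootVec_of_lt G (i := i) (by omega), rootVec_of_lt G hj]
    exact mul_qBracket_qBracket qv_ne_zero qv_add_inv_ne_zero
      (f_mul_rootVec_of_add_one_lt G hi (by omega) (by omega))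
      (G.serre_f (i + 1) i (by omega) (by omega) hi (by omega) (Or.inr rfl))
      (serreRel_f_rootVec G (by omega) hj)
  | of_succ i hi ih =>
    intro hi1 hij
    rw [rootVec_of_lt G (by omega)]
    exact mul_qBracket_of_comm
      (G.comm_f j i (by omega) hj.le hi1 (by omega) (Or.inr (by omega)))
      (ih (by omega) (by omega))

lemma f_top_mul_rootVec {i : ℕ} (hi : 1 ≤ i) (hid : i < d) :
    G.f d * rootVec G i = qv • (rootVec G i * G.f d) := by
  have hij' : i ≤ d - 1 := by omega
  revert hi hid
  induction hij' using Nat.decreasingInduction with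
  | self =>
    intro hi hid
    have h : d - 1 + 1 = d := by omega
    rw [rootVec_of_lt G hid, h, rootVec_top]
    exact mul_qBracket_of_serreRel_swap qv_ne_zero
      (G.serre_f d (d - 1) (by omega) le_rfl hi hid.le (Or.inr h))
  | of_succ i hi ih =>
    intro hi1 hid
    rw [rootVec_of_lt G hid]
    exact mul_qBracket_of_comm_left
      (G.comm_f d i (by omega) le_rfl hi1 hid.le (Or.inr (by omega)))
      (ih (by omega) (by omega))

lemma rootVec_mul_rootVec {i j : ℕ} (hi : 1 ≤ i) (hij : i < j) (hj : j ≤ d) :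
    rootVec G j * rootVec G i = qv • (rootVec G i * rootVec G j) := by
  revert hij
  induction hj using Nat.decreasingInduction with
  | self =>
    intro hij
    rw [rootVec_top]
    exact f_top_mul_rootVec G hi hij
  | of_succ j hj ih =>
    intro hij
    rw [rootVec_of_lt G hj]
    exact qBracket_mul_of_comm (f_mul_rootVec_of_lt G hi hij hj) (ih (by omega))

/-! ### Weight vectors and highest weight modules -/

variable {G}

lemma IsWtVec.Kinv_smul {u : V} {μ : ℕ → ℤ} (hu : IsWtVec G u μ) {i : ℕ} (hi : 1 ≤ i)
    (hid : i ≤ d) : G.Kinv i • u = qv ^ (-μ i) • u := by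
  have h := congrArg (G.Kinv i • ·) (hu i hi hid)
  beta_reduce at h
  rw [← mul_smul, G.Kinv_mul_K i hi hid, one_smul, smul_comm] at h
  rw [zpow_neg, eq_inv_smul_iff₀ (zpow_ne_zero _ qv_ne_zero), ← h]

lemma K_mul_of_conj {i : ℕ} (hi : 1 ≤ i) (hid : i ≤ d) {x : G.U} {c : KK}
    (h : G.K i * x * G.Kinv i = c • x) : G.K i * x = c • (x * G.K i) := by
  rw [← smul_mul_assoc, ← h, mul_assoc _ (G.Kinv i), G.Kinv_mul_K i hi hid, mul_one]

lemma IsWtVec.f_smul {u : V} {μ : ℕ → ℤ} (hu : IsWtVec G u μ) {j : ℕ} (hj : 1 ≤ j)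
    (hjd : j ≤ d) : IsWtVec G (G.f j • u) (fun i => μ i - cartan i j) := by
  intro i hi hid
  rw [← mul_smul, K_mul_of_conj hi hid (G.K_f_Kinv i j hi hid hj hjd), smul_assoc, mul_smul,
    hu i hi hid, smul_comm (G.f j), smul_smul, ← zpow_add₀ qv_ne_zero, neg_add_eq_sub]

lemma IsWtVec.f_pow_smul {u : V} {μ : ℕ → ℤ} (hu : IsWtVec G u μ) {j : ℕ} (hj : 1 ≤ j)
    (hjd : j ≤ d) (n : ℕ) : IsWtVec G (G.f j ^ n • u) (fun i => μ i - n * cartan i j) := by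
  induction n with
  | zero => simpa using hu
  | succ n ih =>
    rw [pow_succ', mul_smul]
    convert ih.f_smul hj hjd using 2
    push_cast
    ring

variable (G)

/-- The vectors obtained from `s` by applying words in the `f_i`, `1 ≤ i ≤ b`. -/
inductive IsFWord (b : ℕ) (s : Set V) : V → Prop
  | base (w : V) (hw : w ∈ s) : IsFWord b s w
  | step (i : ℕ) (hi : 1 ≤ i) (hib : i ≤ b) (w : V) (hw : IsFWord b s w) : IsFWord b s (G.f i • w)

/-- The smallest subspace containing `s` and stable under the `f_i`, `1 ≤ i ≤ b`. -/
def fSpan (b : ℕ) (s : Set V) : Submodule KK V := Submodule.span KK {w | IsFWord G b s w}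

variable {G}

omit [IsScalarTower KK G.U V] in
lemma subset_fSpan {b : ℕ} {s : Set V} {w : V} (hw : w ∈ s) : w ∈ fSpan G b s :=
  Submodule.subset_span (IsFWord.base w hw)

omit [IsScalarTower KK G.U V] in
lemma fSpan_le {b : ℕ} {s : Set V} {S : Submodule KK V} (hs : s ⊆ S)
    (hf : ∀ i, 1 ≤ i → i ≤ b → ∀ w ∈ S, G.f i • w ∈ S) : fSpan G b s ≤ S := by
  refine Submodule.span_le.mpr fun w hw => ?_
  induction hw with
  | base w hw => exact hs hw
  | step i hi hib w _ ih => exact hf i hi hib w ih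

lemma smul_mem_of_forall_mem_span {s : Set V} {S : Submodule KK V} {p : G.U}
    (h : ∀ w ∈ s, p • w ∈ S) : ∀ w ∈ Submodule.span KK s, p • w ∈ S := by
  have : Submodule.span KK s ≤ S.comap (Algebra.lsmul KK KK V p) := Submodule.span_le.mpr h
  exact this

lemma f_smul_mem_fSpan {b : ℕ} {s : Set V} {i : ℕ} (hi : 1 ≤ i) (hib : i ≤ b) {w : V}
    (hw : w ∈ fSpan G b s) : G.f i • w ∈ fSpan G b s :=
  smul_mem_of_forall_mem_span
    (fun w hw => Submodule.subset_span (IsFWord.step i hi hib w hw)) w hw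

lemma IsHWModule.isWtVec_of_isFWord {lam : ℕ → ℤ} {v : V} (hV : IsHWModule G lam v) {w : V}
    (hw : IsFWord G d {v} w) : ∃ μ, IsWtVec G w μ := by
  induction hw with
  | base w hw => exact ⟨lam, (Set.mem_singleton_iff.mp hw) ▸ hV.wt⟩
  | step i hi hib w _ ih =>
    obtain ⟨μ, hμ⟩ := ih
    exact ⟨_, hμ.f_smul hi hib⟩

lemma e_smul_f_smul {i j : ℕ} (hi : 1 ≤ i) (hid : i ≤ d) (hj : 1 ≤ j) (hjd : j ≤ d) (w : V) :
    G.e i • G.f j • w = G.f j • G.e i • w +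
      if i = j then (qv - qv⁻¹)⁻¹ • (G.K i • w - G.Kinv i • w) else 0 := by
  rw [← mul_smul, sub_eq_iff_eq_add'.mp (G.e_f_comm i j hi hid hj hjd), add_smul, mul_smul]
  split_ifs with h
  · rw [smul_assoc, sub_smul]
  · rw [zero_smul]

lemma IsHWModule.fSpan_eq_top {lam : ℕ → ℤ} {v : V} (hV : IsHWModule G lam v) :
    fSpan G d {v} = ⊤ := by
  set P := fSpan G d {v} with hP
  have hK : ∀ i, 1 ≤ i → i ≤ d → ∀ w, IsFWord G d {v} w → G.K i • w ∈ P ∧ G.Kinv i • w ∈ P := by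
    intro i hi hid w hw
    obtain ⟨μ, hμ⟩ := hV.isWtVec_of_isFWord hw
    rw [hμ i hi hid, hμ.Kinv_smul hi hid]
    have := Submodule.subset_span (R := KK) (s := {w | IsFWord G d {v} w}) hw
    exact ⟨P.smul_mem _ this, P.smul_mem _ this⟩
  have he : ∀ i, 1 ≤ i → i ≤ d → ∀ w, IsFWord G d {v} w → G.e i • w ∈ P := by
    intro i hi hid w hw
    induction hw with
    | base w hw =>
      rw [Set.mem_singleton_iff.mp hw, hV.hw i hi hid]
      exact P.zero_mem
    | step j hj hjd w hw ih =>
      rw [e_smul_f_smul hi hid hj hjd]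
      refine P.add_mem (f_smul_mem_fSpan hj hjd ih) ?_
      split_ifs
      · exact P.smul_mem _ (P.sub_mem (hK i hi hid w hw).1 (hK i hi hid w hw).2)
      · exact P.zero_mem
  have hstable : ∀ p : G.U, ∀ w ∈ P, p • w ∈ P := by
    intro p
    induction G.gen p using Algebra.adjoin_induction with
    | mem x hx =>
      obtain ⟨i, hi, hid, rfl | rfl | rfl | rfl⟩ := hx
      · exact smul_mem_of_forall_mem_span (he i hi hid)
      · exact fun w hw => f_smul_mem_fSpan hi hid hw
      · exact smul_mem_of_forall_mem_span fun w hw => (hK i hi hid w hw).1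
      · exact smul_mem_of_forall_mem_span fun w hw => (hK i hi hid w hw).2
    | algebraMap r =>
      intro w hw
      rw [algebraMap_smul]
      exact P.smul_mem _ hw
    | add x y _ _ hx hy =>
      intro w hw
      rw [add_smul]
      exact P.add_mem (hx w hw) (hy w hw)
    | mul x y _ _ hx hy =>
      intro w hw
      rw [mul_smul]
      exact hx _ (hy w hw)
  refine eq_top_iff.mpr fun w _ => ?_
  obtain ⟨p, rfl⟩ := hV.gen w
  exact hstable p v (subset_fSpan rfl)

lemma IsHWModule.f_pow_smul_eq_zero {lam : ℕ → ℤ} {v : V} (hV : IsHWModule G lam v) {i : ℕ}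
    (hi : 1 ≤ i) (hid : i ≤ d) {c : ℕ} (hc : lam i = c) : G.f i ^ (c + 1) • v = 0 := by
  have := hV.findim
  have hwt : ∀ n : ℕ, IsWtVec G (G.f i ^ n • v) (fun r => lam r - n * cartan r i) :=
    hV.wt.f_pow_smul hi hid
  have hcar : cartan i i = 2 := by simp [cartan]
  have hK : ∀ n : ℕ, G.K i • G.f i ^ n • v = qv ^ ((c : ℤ) - 2 * n) • G.f i ^ n • v := fun n => by
    simp only [hwt n i hi hid, hcar, hc, mul_comm]
  have hK' : ∀ n : ℕ, G.Kinv i • G.f i ^ n • v = qv ^ (-((c : ℤ) - 2 * n)) • G.f i ^ n • v :=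
    fun n => by simp only [(hwt n).Kinv_smul hi hid, hcar, hc, mul_comm]
  have hex : ∃ n, G.f i ^ n • v = 0 := by
    by_contra! hne
    have hli := Module.End.eigenvectors_linearIndependent'
      (Algebra.lsmul KK KK V (G.K i)) (fun n : ℕ => qv ^ ((c : ℤ) - 2 * n))
      (fun x y h => by
        have := qv_zpow_injective h
        omega)
      (fun n : ℕ => G.f i ^ n • v)
      (fun n => ⟨Module.End.mem_eigenspace_iff.mpr (hK n), hne n⟩)
    have := hli.finite
    exact not_finite ℕ
  classical
  obtain ⟨n, hn⟩ : ∃ n, Nat.find hex = n + 1 := by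
    refine Nat.exists_eq_succ_of_ne_zero fun h => ?_
    have := Nat.find_spec hex
    rw [h, pow_zero, one_smul] at this
    exact hV.ne_zero this
  have h0 : G.f i ^ (n + 1) • v = 0 := hn ▸ Nat.find_spec hex
  have h1 : G.f i ^ n • v ≠ 0 := Nat.find_min hex (by omega)
  have h2 := smul_pow_succ_smul_of_sl2 qv_ne_zero qv_sub_inv_ne_zero
    (by simpa using G.e_f_comm i i hi hid hi hid) hK hK' (hV.hw i hi hid) n
  rw [h0, smul_zero, eq_comm, smul_eq_zero, or_iff_left h1, div_eq_zero_iff,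
    or_iff_left (pow_ne_zero 2 qv_sub_inv_ne_zero), mul_eq_zero, sub_eq_zero, sub_eq_zero] at h2
  have : n = c := by
    rcases h2 with h2 | h2 <;> have := qv_zpow_injective h2 <;> omega
  rwa [← this]

/-! ### Root vectors acting on a vector killed by all but one `f_i` -/

lemma rootVec_smul_eq_zero {i : ℕ} (hid : i ≤ d) {w : V}
    (hw : ∀ j, i ≤ j → j ≤ d → G.f j • w = 0) : rootVec G i • w = 0 := by
  revert hw
  induction hid using Nat.decreasingInduction with
  | self =>
    intro hw
    rw [rootVec_top]
    exact hw d le_rfl le_rfl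
  | of_succ i hi ih =>
    intro hw
    rw [rootVec_of_lt G hi, qBracket, sub_smul, smul_assoc, mul_smul, mul_smul,
      ih fun j hij => hw j (by omega), hw i le_rfl hi.le]
    simp

lemma rootVec_smul_rootVec_pow_smul_mem {a : ℕ} (ha : 1 ≤ a) (had : a ≤ d) {v : V}
    (hv : ∀ j, 1 ≤ j → j ≤ d → j ≠ a → G.f j • v = 0) {S : Submodule KK V}
    (hS : ∀ n, rootVec G a ^ n • v ∈ S)
    (hf : ∀ j, 1 ≤ j → j < d → ∀ w ∈ S, G.f j • w ∈ S) (n : ℕ) {i : ℕ} (hi : 1 ≤ i)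
    (hid : i ≤ d) : rootVec G i • rootVec G a ^ n • v ∈ S := by
  rcases lt_trichotomy i a with hia | rfl | hia
  · have hia' : i ≤ a - 1 := by omega
    revert hid hi hia
    induction hia' using Nat.decreasingInduction with
    | self =>
      intro hi _ hia
      have h : a - 1 + 1 = a := by omega
      have hX : rootVec G (a - 1) = qBracket qv (G.f (a - 1)) (rootVec G a) := by
        rw [rootVec_of_lt G (by omega), h]
      have h1 := smul_pow_succ_smul_of_qBracket (x := G.f (a - 1)) (y := rootVec G a) (w := v)
        (by
          rw [← hX]
          exact rootVec_mul_rootVec G hi hia had)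
        (hv _ hi (by omega) (by omega)) n
      rw [← hX, ← inv_smul_eq_iff₀] at h1
      · rw [← h1]
        exact S.smul_mem _ (hf _ hi (by omega) _ (hS _))
      · apply geom_sum_ne_zero_of_pow_ne_one
        rw [← pow_mul]
        exact qv_pow_ne_one (by omega)
    | of_succ i hia' ih =>
      intro hi _ hia
      have hcomm : Commute (G.f i) (rootVec G a) :=
        f_mul_rootVec_of_add_one_lt G hi (by omega) had
      have h0 : G.f i • rootVec G a ^ n • v = 0 := by
        rw [← mul_smul, (hcomm.pow_right n).eq, mul_smul, hv i hi (by omega) hia.ne, smul_zero]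
      rw [rootVec_of_lt G (by omega), qBracket, sub_smul, smul_assoc, mul_smul, mul_smul, h0,
        smul_zero, smul_zero, sub_zero]
      exact hf i hi (by omega) _ (ih (by omega) (by omega) (by omega))
  · rw [← mul_smul, ← pow_succ']
    exact hS _
  · have h0 : ∀ n : ℕ, rootVec G i • rootVec G a ^ n • v = 0 := by
      intro n
      induction n with
      | zero =>
        rw [pow_zero, one_smul]
        exact rootVec_smul_eq_zero hid fun j hij hjd => hv j (by omega) hjd (by omega)
      | succ n ih =>
        rw [pow_succ', mul_smul, ← mul_smul, rootVec_mul_rootVec G ha hia hid, smul_assoc,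
          mul_smul, ih, smul_zero, smul_zero]
    rw [h0]
    exact S.zero_mem

lemma rootVec_smul_mem_fSpan {a : ℕ} (ha : 1 ≤ a) (had : a ≤ d) {v : V}
    (hv : ∀ j, 1 ≤ j → j ≤ d → j ≠ a → G.f j • v = 0) {w : V}
    (hw : w ∈ fSpan G (d - 1) (Set.range fun n : ℕ => rootVec G a ^ n • v)) {i : ℕ} (hi : 1 ≤ i)
    (hid : i ≤ d) :
    rootVec G i • w ∈ fSpan G (d - 1) (Set.range fun n : ℕ => rootVec G a ^ n • v) := by
  set T := fSpan G (d - 1) (Set.range fun n : ℕ => rootVec G a ^ n • v) with hT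
  have hf : ∀ j, 1 ≤ j → j < d → ∀ w ∈ T, G.f j • w ∈ T :=
    fun j hj hjd w hw => f_smul_mem_fSpan hj (by omega) hw
  suffices h : ∀ w, IsFWord G (d - 1) (Set.range fun n : ℕ => rootVec G a ^ n • v) w →
      ∀ i, 1 ≤ i → i ≤ d → rootVec G i • w ∈ T from
    smul_mem_of_forall_mem_span (fun w hw => h w hw i hi hid) w hw
  intro w hw
  induction hw with
  | base w hw =>
    obtain ⟨n, rfl⟩ := hw
    exact fun i => rootVec_smul_rootVec_pow_smul_mem ha had hv
      (fun n => subset_fSpan (Set.mem_range_self n)) hf n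
  | step j hj hjd w _ ih =>
    intro i hi hid
    rw [← mul_smul]
    rcases lt_trichotomy i j with hij | rfl | hij
    · rw [← f_mul_rootVec_of_lt G hi hij (by omega), mul_smul]
      exact hf j hj (by omega) _ (ih i hi hid)
    · have h := f_mul_rootVec_self G hi (show i < d by omega)
      rw [eq_inv_smul_iff₀ qv_ne_zero] at h
      rw [← h, smul_assoc, mul_smul]
      exact T.smul_mem _ (hf i hj (by omega) _ (ih i hi hid))
    · rcases (show j + 1 ≤ i from hij).eq_or_lt with rfl | hij'
      · have h : qv • (rootVec G (j + 1) * G.f j) = G.f j * rootVec G (j + 1) - rootVec G j := by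
          rw [rootVec_of_lt G (i := j) (by omega), qBracket, sub_sub_cancel]
        rw [← eq_inv_smul_iff₀ qv_ne_zero] at h
        rw [h, smul_assoc, sub_smul, mul_smul]
        exact T.smul_mem _ (T.sub_mem (hf j hj (by omega) _ (ih _ hi hid))
          (ih j hj (by omega)))
      · rw [← f_mul_rootVec_of_add_one_lt G hj hij' hid, mul_smul]
        exact hf j hj (by omega) _ (ih i hi hid)

lemma IsHWModule.fSpan_rootVec_pow_eq_top {lam : ℕ → ℤ} {v : V} (hV : IsHWModule G lam v) {a : ℕ}
    (ha : 1 ≤ a) (had : a ≤ d) (hv : ∀ j, 1 ≤ j → j ≤ d → j ≠ a → G.f j • v = 0) :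
    fSpan G (d - 1) (Set.range fun n : ℕ => rootVec G a ^ n • v) = ⊤ := by
  rw [← top_le_iff, ← hV.fSpan_eq_top]
  refine fSpan_le ?_ fun i hi hid w hw => ?_
  · rw [Set.singleton_subset_iff]
    exact subset_fSpan ⟨0, by simp⟩
  · rcases hid.lt_or_eq with h | rfl
    · exact f_smul_mem_fSpan hi (by omega) hw
    · rw [← rootVec_top]
      exact rootVec_smul_mem_fSpan ha had hv hw hi hid

/-! ### The vectors `f_{a'}^{(n)} ⋯ f_a^{(n)} v` -/

omit [Module KK V] [IsScalarTower KK G.U V] in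
lemma fDivChain_of_lt {c : ℕ → ℕ} {a a' : ℕ} (h : a' < a) (v : V) :
    fDivChain G c a a' v = v := by
  simp [fDivChain, show a' + 1 - a = 0 by omega]

omit [Module KK V] [IsScalarTower KK G.U V] in
lemma fDivChain_succ {c : ℕ → ℕ} {a a' : ℕ} (h : a ≤ a' + 1) (v : V) :
    fDivChain G c a (a' + 1) v = fDiv G (a' + 1) (c (a' + 1)) • fDivChain G c a a' v := by
  rw [fDivChain, show a' + 1 + 1 - a = a' + 1 - a + 1 by omega, List.range_succ,
    List.foldl_append]
  simp only [List.foldl_cons, List.foldl_nil, show a + (a' + 1 - a) = a' + 1 by omega, fDivChain]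

omit [Module KK V] [IsScalarTower KK G.U V] in
lemma fDivChain_of_le {c : ℕ → ℕ} {a a' : ℕ} (ha : 1 ≤ a) (h : a ≤ a') (v : V) :
    fDivChain G c a a' v = fDiv G a' (c a') • fDivChain G c a (a' - 1) v := by
  obtain ⟨a', rfl⟩ := Nat.exists_eq_add_of_le' (ha.trans h)
  rw [fDivChain_succ h, Nat.add_sub_cancel]

lemma fDiv_comm {x : G.U} {i : ℕ} (n : ℕ) (h : x * G.f i = G.f i * x) :
    x * fDiv G i n = fDiv G i n * x := by
  have : Commute x (G.f i) := h
  simp only [fDiv, mul_smul_comm, smul_mul_assoc, (this.pow_right n).eq]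

omit [Module KK V] [IsScalarTower KK G.U V] in
lemma smul_fDivChain_of_comm {c : ℕ → ℕ} {a a' : ℕ} {x : G.U} (v : V)
    (h : ∀ i, a ≤ i → i ≤ a' → x * G.f i = G.f i * x) :
    x • fDivChain G c a a' v = fDivChain G c a a' (x • v) := by
  rcases lt_or_ge a' a with haa | haa
  · rw [fDivChain_of_lt haa, fDivChain_of_lt haa]
  induction a' with
  | zero =>
    obtain rfl : a = 0 := by omega
    simp only [fDivChain, zero_add, Nat.sub_zero, List.range_one, List.foldl_cons,
      List.foldl_nil]
    rw [← mul_smul, fDiv_comm _ (h 0 le_rfl le_rfl), mul_smul]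
  | succ a' ih =>
    rw [fDivChain_succ haa, fDivChain_succ haa, ← mul_smul, fDiv_comm _ (h _ haa le_rfl), mul_smul]
    rcases haa.eq_or_lt with h1 | h1
    · rw [fDivChain_of_lt (by omega), fDivChain_of_lt (by omega)]
    · rw [ih (fun i hi hia => h i hi (by omega)) (by omega)]

lemma exists_rootVec_pow_smul_fDivChain {a : ℕ} (ha : 1 ≤ a) {v : V}
    (hv : ∀ j, 1 ≤ j → j ≤ d → j ≠ a → G.f j • v = 0) (n : ℕ) {i : ℕ} (hai : a ≤ i) (hid : i ≤ d) :
    ∃ c : KK, c ≠ 0 ∧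
      rootVec G i ^ n • fDivChain G (fun _ => n) a (i - 1) v = c • rootVec G a ^ n • v := by
  induction i, hai using Nat.le_induction with
  | base => exact ⟨1, one_ne_zero, by rw [fDivChain_of_lt (by omega), one_smul]⟩
  | succ i hai ih =>
    obtain ⟨c, hc, h⟩ := ih (by omega)
    have hchain : fDivChain G (fun _ => n) a i v =
        (qFact n)⁻¹ • G.f i ^ n • fDivChain G (fun _ => n) a (i - 1) v := by
      rw [fDivChain_of_le ha hai, fDiv, smul_assoc]
    set u := fDivChain G (fun _ => n) a (i - 1) v with hu
    have hX : rootVec G i = qBracket qv (G.f i) (rootVec G (i + 1)) := rootVec_of_lt G hid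
    have hzero : rootVec G (i + 1) • u = 0 := by
      rw [hu, smul_fDivChain_of_comm, rootVec_smul_eq_zero hid
        fun j hj hjd => hv j (by omega) hjd (by omega)]
      · have h0 := smul_fDivChain_of_comm (c := fun _ => n) (a := a) (a' := i - 1) (x := (0 : G.U)) v
          (by simp)
        rw [zero_smul, zero_smul] at h0
        exact h0.symm
      · exact fun j hj hji => (f_mul_rootVec_of_add_one_lt G (by omega) (by omega) hid).symm
    obtain ⟨c', hc', h'⟩ := exists_pow_smul_pow_smul_eq (fun m hm => qv_pow_ne_one hm) qv_ne_zero
      (by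
        rw [← hX]
        exact f_mul_rootVec_self G (by omega) hid)
      (by
        rw [← hX]
        exact rootVec_mul_rootVec G (by omega) (by omega) hid) hzero n
    refine ⟨(qFact n)⁻¹ * (c' * c), ?_, ?_⟩
    · exact mul_ne_zero (inv_ne_zero (qFact_ne_zero n)) (mul_ne_zero hc' hc)
    · rw [Nat.add_sub_cancel, hchain, smul_comm, h', ← hX, h, smul_smul, smul_smul, mul_assoc]

lemma exists_fDivChain_eq {a : ℕ} (ha : 1 ≤ a) (had : a ≤ d) {v : V}
    (hv : ∀ j, 1 ≤ j → j ≤ d → j ≠ a → G.f j • v = 0) (n : ℕ) :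
    ∃ c : KK, c ≠ 0 ∧ fDivChain G (fun _ => n) a d v = c • rootVec G a ^ n • v := by
  obtain ⟨c, hc, h⟩ := exists_rootVec_pow_smul_fDivChain ha hv n had le_rfl
  refine ⟨(qFact n)⁻¹ * c, mul_ne_zero (inv_ne_zero (qFact_ne_zero n)) hc, ?_⟩
  rw [fDivChain_of_le ha had, fDiv, smul_assoc, ← rootVec_top, h, smul_smul]

lemma rootVec_pow_smul_eq_zero {a : ℕ} (ha : 1 ≤ a) (had : a ≤ d) {v : V}
    (hv : ∀ j, 1 ≤ j → j ≤ d → j ≠ a → G.f j • v = 0) {n : ℕ} (hn : G.f a ^ n • v = 0) :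
    rootVec G a ^ n • v = 0 := by
  obtain ⟨c, hc, h⟩ := exists_fDivChain_eq ha had hv n
  have h0 : ∀ i, a ≤ i → fDivChain G (fun _ => n) a i v = 0 := by
    intro i hi
    induction i, hi using Nat.le_induction with
    | base =>
      rw [fDivChain_of_le ha le_rfl, fDivChain_of_lt (by omega), fDiv, smul_assoc, hn, smul_zero]
    | succ i hi ih => rw [fDivChain_succ (by omega), ih, smul_zero]
  rw [h0 d had, eq_comm, smul_eq_zero, or_iff_right hc] at h
  exact h

/-! ### Stability of `U_q(sl_{b+1}) x` -/

omit [IsScalarTower KK G.U V] in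
lemma self_mem_USpan (b : ℕ) (x : V) : x ∈ USpan G b x :=
  Submodule.subset_span ⟨1, one_mem _, (one_smul _ _).symm⟩

lemma smul_mem_USpan {b : ℕ} {x : V} {p : G.U} (hp : p ∈ Usub G b) {w : V}
    (hw : w ∈ USpan G b x) : p • w ∈ USpan G b x := by
  refine smul_mem_of_forall_mem_span ?_ w hw
  rintro _ ⟨r, hr, rfl⟩
  exact Submodule.subset_span ⟨p * r, mul_mem hp hr, (mul_smul _ _ _).symm⟩

lemma iSup_USpan_fDivChain_eq_top {a m : ℕ} (ha : 1 ≤ a) (had : a ≤ d) {v : V}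
    (hV : IsHWModule G (omWt a m) v) :
    (⨆ j : Fin (m + 1), USpan G (d - 1) (fDivChain G (fun _ => j.1) a d v)) = ⊤ := by
  have hv : ∀ j, 1 ≤ j → j ≤ d → j ≠ a → G.f j • v = 0 := fun j hj hjd hja => by
    simpa using hV.f_pow_smul_eq_zero hj hjd (c := 0) (by simp [omWt, hja])
  have hm : G.f a ^ (m + 1) • v = 0 := hV.f_pow_smul_eq_zero ha had (by simp [omWt])
  set W := ⨆ j : Fin (m + 1), USpan G (d - 1) (fDivChain G (fun _ => j.1) a d v) with hW
  rw [← top_le_iff, ← hV.fSpan_rootVec_pow_eq_top ha had hv]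
  refine fSpan_le ?_ fun i hi hid w hw => ?_
  · rintro _ ⟨n, rfl⟩
    rcases lt_or_ge n (m + 1) with hn | hn
    · obtain ⟨c, hc, h⟩ := exists_fDivChain_eq ha had hv n
      have hmem : fDivChain G (fun _ => n) a d v ∈ W :=
        Submodule.mem_iSup_of_mem (⟨n, hn⟩ : Fin (m + 1)) (self_mem_USpan _ _)
      rw [← inv_smul_eq_iff₀ hc] at h
      beta_reduce
      rw [← h]
      exact W.smul_mem _ hmem
    · have h0 : rootVec G a ^ n • v = 0 := rootVec_pow_smul_eq_zero ha had hv (by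
        rw [← Nat.sub_add_cancel hn, pow_add, mul_smul, hm, smul_zero])
      beta_reduce
      rw [h0]
      exact W.zero_mem
  · have hp : G.f i ∈ Usub G (d - 1) :=
      Algebra.subset_adjoin ⟨i, hi, hid, Or.inr (Or.inl rfl)⟩
    have : W ≤ W.comap (Algebra.lsmul KK KK V (G.f i)) :=
      iSup_le fun j x hx => Submodule.mem_iSup_of_mem j (smul_mem_USpan hp hx)
    exact this hw

/-! ### The grading by the coefficient of `α_d` -/

variable (G) in
/-- The element `q^{h_1 + 2 h_2 + ⋯ + n h_n}`. -/
def cartanProd : ℕ → G.U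
  | 0 => 1
  | n + 1 => G.K (n + 1) ^ (n + 1) * cartanProd n

lemma cartanProd_mul {x : G.U} {c : ℕ → ℤ} {n : ℕ}
    (h : ∀ i, 1 ≤ i → i ≤ n → G.K i * x = qv ^ c i • (x * G.K i)) :
    cartanProd G n * x =
      qv ^ (∑ i ∈ Finset.range n, ((i : ℤ) + 1) * c (i + 1)) • (x * cartanProd G n) := by
  induction n with
  | zero => simp [cartanProd]
  | succ n ih =>
    rw [cartanProd, mul_assoc, ih fun i hi hin => h i hi (by omega), mul_smul_comm, ← mul_assoc,
      pow_mul_of_qComm (h (n + 1) (by omega) le_rfl), smul_mul_assoc, smul_smul, mul_assoc,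
      Finset.sum_range_succ, zpow_add₀ qv_ne_zero, mul_comm ((n : ℤ) + 1), zpow_mul]
    norm_cast

lemma sum_mul_cartan {j : ℕ} (hj : 1 ≤ j) (n : ℕ) :
    ∑ i ∈ Finset.range n, ((i : ℤ) + 1) * cartan (i + 1) j =
      if n + 1 < j then 0 else if n + 1 = j then -(n : ℤ) else if n = j then (j : ℤ) + 1 else 0 := by
  induction n with
  | zero =>
    simp only [Finset.range_zero, Finset.sum_empty]
    split_ifs <;> omega
  | succ n ih =>
    rw [Finset.sum_range_succ, ih]
    unfold cartan
    rcases (show n + 3 < j ∨ n + 3 = j ∨ n + 2 = j ∨ n + 1 = j ∨ n = j ∨ j < n by omega) with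
      h | h | h | h | h | h
    all_goals
      simp only [mul_ite, mul_neg, mul_one, mul_zero]
      push_cast
      split_ifs <;> omega

lemma cartanProd_mul_f_of_lt {j : ℕ} (hj : 1 ≤ j) (hjd : j < d) :
    cartanProd G d * G.f j = G.f j * cartanProd G d := by
  rw [cartanProd_mul (c := fun i => -cartan i j)
    fun i hi hid => K_mul_of_conj hi hid (G.K_f_Kinv i j hi hid hj hjd.le)]
  simp only [mul_neg, Finset.sum_neg_distrib, sum_mul_cartan hj]
  simp [show ¬ d + 1 < j by omega, show d + 1 ≠ j by omega, hjd.ne']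

lemma cartanProd_mul_f_top (hd : 1 ≤ d) :
    cartanProd G d * G.f d = qv ^ (-((d : ℤ) + 1)) • (G.f d * cartanProd G d) := by
  rw [cartanProd_mul (c := fun i => -cartan i d)
    fun i hi hid => K_mul_of_conj hi hid (G.K_f_Kinv i d hi hid hd le_rfl)]
  simp only [mul_neg, Finset.sum_neg_distrib, sum_mul_cartan hd]
  simp

lemma cartanProd_mul_e_of_lt {j : ℕ} (hj : 1 ≤ j) (hjd : j < d) :
    cartanProd G d * G.e j = G.e j * cartanProd G d := by
  rw [cartanProd_mul (c := fun i => cartan i j)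
    fun i hi hid => K_mul_of_conj hi hid (G.K_e_Kinv i j hi hid hj hjd.le)]
  simp only [sum_mul_cartan hj]
  simp [show ¬ d + 1 < j by omega, show d + 1 ≠ j by omega, hjd.ne']

lemma cartanProd_mul_K {j : ℕ} (hj : 1 ≤ j) (hjd : j ≤ d) :
    cartanProd G d * G.K j = G.K j * cartanProd G d := by
  rw [cartanProd_mul (c := fun _ => 0)
    fun i hi hid => by rw [zpow_zero, one_smul, G.K_comm i j hi hid hj hjd]]
  simp

lemma cartanProd_mul_Kinv {j : ℕ} (hj : 1 ≤ j) (hjd : j ≤ d) :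
    cartanProd G d * G.Kinv j = G.Kinv j * cartanProd G d := by
  calc cartanProd G d * G.Kinv j
      = G.Kinv j * (G.K j * cartanProd G d) * G.Kinv j := by
        rw [← mul_assoc, G.Kinv_mul_K j hj hjd, one_mul]
    _ = G.Kinv j * cartanProd G d := by
        rw [← cartanProd_mul_K hj hjd, mul_assoc, mul_assoc, G.K_mul_Kinv j hj hjd, mul_one]

lemma cartanProd_comm_of_mem_Usub {p : G.U} (hp : p ∈ Usub G (d - 1)) :
    Commute (cartanProd G d) p := by
  induction hp using Algebra.adjoin_induction with
  | mem x hx =>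
    obtain ⟨i, hi, hid, rfl | rfl | rfl | rfl⟩ := hx
    · exact cartanProd_mul_e_of_lt hi (by omega)
    · exact cartanProd_mul_f_of_lt hi (by omega)
    · exact cartanProd_mul_K hi (by omega)
    · exact cartanProd_mul_Kinv hi (by omega)
  | algebraMap r => exact (Algebra.commutes r _).symm
  | add x y _ _ hx hy => exact hx.add_right hy
  | mul x y _ _ hx hy => exact hx.mul_right hy

lemma IsWtVec.exists_cartanProd_smul {v : V} {μ : ℕ → ℤ} (hv : IsWtVec G v μ) {n : ℕ}
    (hn : n ≤ d) : ∃ N : ℤ, cartanProd G n • v = qv ^ N • v := by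
  induction n with
  | zero => exact ⟨0, by simp [cartanProd]⟩
  | succ n ih =>
    obtain ⟨N, hN⟩ := ih (by omega)
    have hpow : ∀ t : ℕ, G.K (n + 1) ^ t • v = qv ^ (μ (n + 1) * t) • v := by
      intro t
      induction t with
      | zero => simp
      | succ t iht =>
        rw [pow_succ', mul_smul, iht, smul_comm, hv (n + 1) (by omega) hn, smul_smul,
          ← zpow_add₀ qv_ne_zero]
        congr 2
        push_cast
        ring
    refine ⟨N + μ (n + 1) * (n + 1 : ℕ), ?_⟩
    rw [cartanProd, mul_smul, hN, smul_comm, hpow, smul_smul, ← zpow_add₀ qv_ne_zero]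

lemma IsWtVec.exists_cartanProd_smul_fDivChain {a : ℕ} (ha : 1 ≤ a) (had : a ≤ d) {v : V}
    {μ : ℕ → ℤ} (hv : IsWtVec G v μ) :
    ∃ N : ℤ, ∀ n : ℕ, cartanProd G d • fDivChain G (fun _ => n) a d v =
      qv ^ (N - (d + 1) * n) • fDivChain G (fun _ => n) a d v := by
  obtain ⟨N, hN⟩ := hv.exists_cartanProd_smul le_rfl
  refine ⟨N, fun n => ?_⟩
  have hmul : cartanProd G d * fDiv G d n =
      qv ^ (-((d : ℤ) + 1) * n) • (fDiv G d n * cartanProd G d) := by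
    rw [fDiv, mul_smul_comm, mul_pow_of_qComm (cartanProd_mul_f_top (ha.trans had)),
      smul_mul_assoc, smul_comm, zpow_mul, zpow_natCast]
  rw [fDivChain_of_le ha had, ← mul_smul, hmul, smul_assoc, mul_smul,
    smul_fDivChain_of_comm v fun i hai hid => cartanProd_mul_f_of_lt (by omega) (by omega), hN,
    ← algebraMap_smul G.U (qv ^ N), ← smul_fDivChain_of_comm v fun i _ _ => Algebra.commutes _ _,
    algebraMap_smul, smul_comm (fDiv G d n), smul_smul, ← zpow_add₀ qv_ne_zero]
  congr 2
  ring

lemma iSupIndep_USpan_fDivChain {a m : ℕ} (ha : 1 ≤ a) (had : a ≤ d) {v : V} {μ : ℕ → ℤ}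
    (hv : IsWtVec G v μ) :
    iSupIndep fun j : Fin (m + 1) => USpan G (d - 1) (fDivChain G (fun _ => j.1) a d v) := by
  obtain ⟨N, hN⟩ := hv.exists_cartanProd_smul_fDivChain ha had
  have hinj : Function.Injective fun j : Fin (m + 1) => qv ^ (N - (d + 1) * (j.1 : ℤ)) := by
    intro i j h
    have h1 := qv_zpow_injective h
    have h2 : ((d : ℤ) + 1) * i.1 = (d + 1) * j.1 := by linarith
    have h3 := mul_left_cancel₀ (by omega) h2
    exact Fin.ext (by exact_mod_cast h3)
  refine ((Module.End.eigenspaces_iSupIndep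
    (Algebra.lsmul KK KK V (cartanProd G d))).comp hinj).mono fun j => ?_
  refine Submodule.span_le.mpr ?_
  rintro _ ⟨p, hp, rfl⟩
  refine Module.End.mem_eigenspace_iff.mpr ?_
  change cartanProd G d • p • fDivChain G (fun _ => j.1) a d v = _
  rw [← mul_smul, (cartanProd_comm_of_mem_Usub hp).eq, mul_smul, hN, smul_comm]

/-- Theorem `decomp`:  for `λ = m ω_a`,
`V^λ = ⊕_{j=0}^{m} U_q(sl_{k-1}) v_j` as an internal direct sum of
`U_q(sl_{k-1})`-submodules, where `v_j = f_{k-1}^{(j)} ⋯ f_a^{(j)} v_λ`. -/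
theorem restriction_direct_sum_decomposition
    (k a m : ℕ) (hk : 3 ≤ k) (ha : 1 ≤ a) (hak : a ≤ k - 1) (hm : 1 ≤ m)
    (G : QGroup (k - 1)) (V : Type) [AddCommGroup V] [Module KK V] [Module G.U V]
    [IsScalarTower KK G.U V]
    (v : V) (hV : IsHWModule G (omWt a m) v) :
    (⨆ j : Fin (m + 1),
        USpan G (k - 2) (fDivChain G (fun _ => j.1) a (k - 1) v)) = ⊤ ∧
    (∀ j : Fin (m + 1),
      Disjoint (USpan G (k - 2) (fDivChain G (fun _ => j.1) a (k - 1) v))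
        (⨆ j' : Fin (m + 1), ⨆ _ : j' ≠ j,
          USpan G (k - 2) (fDivChain G (fun _ => j'.1) a (k - 1) v))) := by
  exact ⟨iSup_USpan_fDivChain_eq_top ha hak hV, iSupIndep_USpan_fDivChain ha hak hV.wt⟩

end QSL
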